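/- For every integer m ≥ 1, writing s = n − 2m, one has (2n − 6s)·Ma_m(P) ≤ (68/3)·(s + 2)·Ma_{m−1}(P). -/

import Mathlib

open scoped Classical

noncomputable section

/-- A point of the plane. -/
abbrev Pt : Type := ℝ × ℝ

/-- The closed straight-line segment with endpoints `a` and `b`. -/
def Seg (a b : Pt) : Set Pt := segment ℝ a b

/-- `P` is in general position: no three points of `P` are collinear and
no two points of `P` have the same `x`-coordinate. -/
def GenPos (P : Finset Pt) : Prop :=
  (∀ p ∈ P, ∀ q ∈ P, ∀ r ∈ P, p ≠ q → q ≠ r → p ≠ r →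
      ¬ Collinear ℝ ({p, q, r} : Set Pt)) ∧
  ∀ p ∈ P, ∀ q ∈ P, p ≠ q → p.1 ≠ q.1

/-- `M` is a crossing-free matching of `P`.  Each edge is recorded as an ordered
pair `(left endpoint, right endpoint)`, the left endpoint being the one of
smaller `x`-coordinate.  No point is an endpoint of more than one edge and no
two distinct edges intersect. -/
structure IsMatching (P : Finset Pt) (M : Finset (Pt × Pt)) : Prop where
  left_mem : ∀ e ∈ M, e.1 ∈ P
  right_mem : ∀ e ∈ M, e.2 ∈ P
  x_lt : ∀ e ∈ M, e.1.1 < e.2.1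
  no_shared : ∀ e ∈ M, ∀ f ∈ M, e ≠ f →
      e.1 ≠ f.1 ∧ e.1 ≠ f.2 ∧ e.2 ≠ f.1 ∧ e.2 ≠ f.2
  no_cross : ∀ e ∈ M, ∀ f ∈ M, e ≠ f → Seg e.1 e.2 ∩ Seg f.1 f.2 = ∅

/-- `p` is isolated in `M`: it is an endpoint of no edge of `M`. -/
def Isolated (M : Finset (Pt × Pt)) (p : Pt) : Prop :=
  ∀ e ∈ M, e.1 ≠ p ∧ e.2 ≠ p

/-- The `y`-coordinate of the point of the line through the endpoints of `e`
having abscissa `x`. -/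
def yOn (e : Pt × Pt) (x : ℝ) : ℝ :=
  e.1.2 + (x - e.1.1) * (e.2.2 - e.1.2) / (e.2.1 - e.1.1)

/-- The point of (the line supporting) the edge `e` with the same
`x`-coordinate as `q`. -/
def vproj (e : Pt × Pt) (q : Pt) : Pt := (q.1, yOn e q.1)

/-- `q` is vertically visible from the interior of the edge `e` of `M`:
its `x`-coordinate lies strictly between the `x`-coordinates of the endpoints
of `e`, and the open vertical segment joining `q` to the point of `e` with the
same `x`-coordinate meets no edge of `M` and contains no point of `P`. -/
def VertVisible (P : Finset Pt) (M : Finset (Pt × Pt)) (q : Pt) (e : Pt × Pt) : Prop :=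
  e.1.1 < q.1 ∧ q.1 < e.2.1 ∧
  (∀ f ∈ M, openSegment ℝ q (vproj e q) ∩ Seg f.1 f.2 = ∅) ∧
  ∀ r ∈ P, r ∉ openSegment ℝ q (vproj e q)

/-- `p` is the left endpoint of some edge of `M`. -/
def IsLeftEndpoint (M : Finset (Pt × Pt)) (p : Pt) : Prop := ∃ e ∈ M, e.1 = p

/-- `p` is the right endpoint of some edge of `M`. -/
def IsRightEndpoint (M : Finset (Pt × Pt)) (p : Pt) : Prop := ∃ e ∈ M, e.2 = p

/-- The rank `d_M(p)` of `p` in `M`. -/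
def rank (P : Finset Pt) (M : Finset (Pt × Pt)) (p : Pt) : ℕ :=
  if h : ∃ e ∈ M, e.1 = p then
    (P.filter fun q =>
      (Isolated M q ∨ IsLeftEndpoint M q) ∧ VertVisible P M q h.choose).card
  else if h' : ∃ e ∈ M, e.2 = p then
    (P.filter fun q =>
      (Isolated M q ∨ IsRightEndpoint M q) ∧ VertVisible P M q h'.choose).card
  else 0

/-- The result of inserting the edge `qp` into `M` (oriented left-to-right). -/
def addEdge (M : Finset (Pt × Pt)) (q p : Pt) : Finset (Pt × Pt) :=
  if q.1 < p.1 then insert (q, p) M else insert (p, q) M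

/-- `h_i(p,M)`: the number of points `q ∈ P` such that `M ∪ {qp}` is a
crossing-free matching of `P` in which `p` has rank `i`. -/
def hcount (P : Finset Pt) (M : Finset (Pt × Pt)) (p : Pt) (i : ℕ) : ℕ :=
  (P.filter fun q =>
    IsMatching P (addEdge M q p) ∧ rank P (addEdge M q p) p = i).card

/-- `l_i(p,M)`: the number of points `q ∈ P` to the left of `p` such that
`M ∪ {qp}` is a crossing-free matching of `P` in which `p` has rank `i`. -/
def lcount (P : Finset Pt) (M : Finset (Pt × Pt)) (p : Pt) (i : ℕ) : ℕ :=
  (P.filter fun q => q.1 < p.1 ∧ IsMatching P (insert (q, p) M) ∧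
    rank P (insert (q, p) M) p = i).card

/-- `v_i(M)`: the number of points of `P` of rank `i` in `M`. -/
def vcount (P : Finset Pt) (M : Finset (Pt × Pt)) (i : ℕ) : ℕ :=
  (P.filter fun p => rank P M p = i).card

/-- The (finite) collection of crossing-free matchings of `P` with `m` edges. -/
def Matchings (P : Finset Pt) (m : ℕ) : Finset (Finset (Pt × Pt)) :=
  (P ×ˢ P).powerset.filter fun M => IsMatching P M ∧ M.card = m

/-- `Ma_m(P)`: the number of crossing-free matchings of `P` with `m` edges. -/
def Ma (P : Finset Pt) (m : ℕ) : ℕ := (Matchings P m).card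

/-- `S_k(m)`: the sum of `Σ_{i=0}^{k} (k-i) h_i(p,M')` over all pairs `(p, M')`
with `M'` a crossing-free matching of `P` with `m-1` edges and `p ∈ P`
isolated in `M'`. -/
def Ssum (P : Finset Pt) (k m : ℕ) : ℕ :=
  ∑ M ∈ Matchings P (m - 1), ∑ p ∈ P.filter (fun p => Isolated M p),
    ∑ i ∈ Finset.range (k + 1), (k - i) * hcount P M p i

/-- The union of the edges of `M`, as a subset of the plane. -/
def edgesSet (M : Finset (Pt × Pt)) : Set Pt := ⋃ e ∈ M, Seg e.1 e.2

/-- The vertical wall of `r`: the maximal open vertical segment through `r`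
meeting no edge of `M` except possibly at `r` itself. -/
def Wall (M : Finset (Pt × Pt)) (r : Pt) : Set Pt :=
  {x : Pt | x.1 = r.1 ∧
    ∀ z : Pt, z.1 = r.1 → z.2 ∈ Set.uIcc x.2 r.2 → z ≠ r → z ∉ edgesSet M}

/-- The complement of the union of all edges of `M` and all vertical walls of
points of `P`; its connected components are the cells of the vertical
decomposition. -/
def FreeRegion (P : Finset Pt) (M : Finset (Pt × Pt)) : Set Pt :=
  (edgesSet M ∪ ⋃ r ∈ P, Wall M r)ᶜ

/-- `T` is a cell of the vertical decomposition of `M`. -/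
def IsCell (P : Finset Pt) (M : Finset (Pt × Pt)) (T : Set Pt) : Prop :=
  ∃ x ∈ FreeRegion P M, T = connectedComponentIn (FreeRegion P M) x

/-- `T` is the cell containing the points `(x(p) - ε, y(p))` for all
sufficiently small `ε > 0`. -/
def IsLeftCellOf (P : Finset Pt) (M : Finset (Pt × Pt)) (p : Pt) (T : Set Pt) : Prop :=
  IsCell P M T ∧ ∃ ε₀ > (0 : ℝ), ∀ ε : ℝ, 0 < ε → ε < ε₀ →
    ((p.1 - ε, p.2) : Pt) ∈ T

/-- `T` is the cell containing the points `(x(p) + ε, y(p))` for all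
sufficiently small `ε > 0`. -/
def IsRightCellOf (P : Finset Pt) (M : Finset (Pt × Pt)) (p : Pt) (T : Set Pt) : Prop :=
  IsCell P M T ∧ ∃ ε₀ > (0 : ℝ), ∀ ε : ℝ, 0 < ε → ε < ε₀ →
    ((p.1 + ε, p.2) : Pt) ∈ T

/-- `q` is the left bifurcation point of `p`: part of the boundary of the cell
to the left of `p` lies on the vertical wall of `q`, and `x(q)` is the infimum
of the abscissas of points of that cell. -/
def IsLeftBifPoint (P : Finset Pt) (M : Finset (Pt × Pt)) (p q : Pt) : Prop :=
  q ∈ P ∧ ∃ T, IsLeftCellOf P M p T ∧ (frontier T ∩ Wall M q).Nonempty ∧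
    IsGLB {x : ℝ | ∃ y : ℝ, ((x, y) : Pt) ∈ T} q.1

/-- `q` is the right bifurcation point of `p`. -/
def IsRightBifPoint (P : Finset Pt) (M : Finset (Pt × Pt)) (p q : Pt) : Prop :=
  q ∈ P ∧ ∃ T, IsRightCellOf P M p T ∧ (frontier T ∩ Wall M q).Nonempty ∧
    IsLUB {x : ℝ | ∃ y : ℝ, ((x, y) : Pt) ∈ T} q.1

/-- The edge `e` of `M` is vertically visible below `p`. -/
def EdgeVisBelow (P : Finset Pt) (M : Finset (Pt × Pt)) (e : Pt × Pt) (p : Pt) : Prop :=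
  e.1.1 < p.1 ∧ p.1 < e.2.1 ∧ yOn e p.1 < p.2 ∧
  (∀ f ∈ M, openSegment ℝ p (vproj e p) ∩ Seg f.1 f.2 = ∅) ∧
  ∀ r ∈ P, r ∉ openSegment ℝ p (vproj e p)

/-- The edge `e` of `M` is vertically visible above `p`. -/
def EdgeVisAbove (P : Finset Pt) (M : Finset (Pt × Pt)) (e : Pt × Pt) (p : Pt) : Prop :=
  e.1.1 < p.1 ∧ p.1 < e.2.1 ∧ p.2 < yOn e p.1 ∧
  (∀ f ∈ M, openSegment ℝ p (vproj e p) ∩ Seg f.1 f.2 = ∅) ∧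
  ∀ r ∈ P, r ∉ openSegment ℝ p (vproj e p)

end

/-- Data of a sweep: points, edges, the sweep coordinate and edge heights. -/
structure Cfg where
  P : Finset Pt
  M : Finset (Pt × Pt)
  X : Pt → ℝ
  lo : Pt × Pt → Pt
  hi : Pt × Pt → Pt
  v : Pt × Pt → ℝ → ℝ

namespace Cfg

def In (C : Cfg) (e : Pt × Pt) (t : ℝ) : Prop := C.X (C.lo e) ≤ t ∧ t ≤ C.X (C.hi e)

def iso (C : Cfg) (z : Pt) : Prop := ∀ f ∈ C.M, C.lo f ≠ z ∧ C.hi f ≠ z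

def isHi (C : Cfg) (z : Pt) : Prop := ∃ f ∈ C.M, C.hi f = z

structure Ok (C : Cfg) : Prop where
  Xinj : ∀ p ∈ C.P, ∀ q ∈ C.P, C.X p = C.X q → p = q
  loP : ∀ f ∈ C.M, C.lo f ∈ C.P
  hiP : ∀ f ∈ C.M, C.hi f ∈ C.P
  lt : ∀ f ∈ C.M, C.X (C.lo f) < C.X (C.hi f)
  vlo : ∀ e, C.X (C.lo e) < C.X (C.hi e) → C.v e (C.X (C.lo e)) = (C.lo e).2
  vhi : ∀ e, C.X (C.lo e) < C.X (C.hi e) → C.v e (C.X (C.hi e)) = (C.hi e).2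
  aff : ∀ e, ∃ α β : ℝ, ∀ t, C.v e t = α + β * t
  gp : ∀ f ∈ C.M, ∀ z ∈ C.P, C.In f (C.X z) → C.v f (C.X z) = z.2 → z = C.lo f ∨ z = C.hi f
  hihi : ∀ f ∈ C.M, ∀ g ∈ C.M, C.hi f = C.hi g → f = g
  lohi : ∀ f ∈ C.M, ∀ g ∈ C.M, C.lo f ≠ C.hi g

def vis (C : Cfg) (σ : Pt × Pt) (z : Pt) : Prop :=
  C.X (C.lo σ) < C.X z ∧ C.X z < C.X (C.hi σ) ∧
  ∀ f ∈ C.M, C.In f (C.X z) →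
    0 ≤ (C.v f (C.X z) - z.2) * (C.v f (C.X z) - C.v σ (C.X z))

structure adm (C : Cfg) (σ : Pt × Pt) : Prop where
  loP : C.lo σ ∈ C.P
  hiP : C.hi σ ∈ C.P
  iso_lo : C.iso (C.lo σ)
  iso_hi : C.iso (C.hi σ)
  lt : C.X (C.lo σ) < C.X (C.hi σ)
  ne : ∀ f ∈ C.M, ∀ t, C.In f t → C.In σ t → C.v f t ≠ C.v σ t

def free (C : Cfg) (σ τ : Pt × Pt) (t : ℝ) : Prop :=
  ∀ f ∈ C.M, C.In f t → 0 < (C.v f t - C.v σ t) * (C.v f t - C.v τ t)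

noncomputable def nI (C : Cfg) (σ : Pt × Pt) (t : ℝ) : ℕ :=
  (C.P.filter fun z => C.iso z ∧ C.vis σ z ∧ C.X z < t).card

noncomputable def nR (C : Cfg) (σ : Pt × Pt) (t : ℝ) : ℕ :=
  (C.P.filter fun z => C.isHi z ∧ C.vis σ z ∧ C.X z < t).card

def Bun (C : Cfg) (T : Finset (Pt × Pt)) (t : ℝ) : Prop :=
  ∀ σ ∈ T, C.adm σ ∧ C.X (C.lo σ) < t ∧ t ≤ C.X (C.hi σ) ∧ ∀ τ ∈ T, C.free σ τ t

def FR (C : Cfg) (σ : Pt × Pt) (t : ℝ) : Prop :=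
  ∃ q ∈ C.P, C.isHi q ∧ C.vis σ q ∧ C.X q < t ∧
    ∀ w ∈ C.P, C.vis σ w → C.X w < t → (C.iso w ∨ C.isHi w) → C.X w ≤ C.X q

def LH (C : Cfg) (a : Pt) : Prop := ∃ τ, C.adm τ ∧ C.hi τ = a ∧ C.FR τ (C.X a)

variable {C : Cfg}

theorem iso_not_hi {z : Pt} (h : C.iso z) : ¬ C.isHi z := by
  rintro ⟨f, hf, rfl⟩
  exact (h f hf).2 rfl

theorem aff_sign {g : ℝ → ℝ} {α β a b : ℝ} (hg : ∀ t, g t = α + β * t) (hab : a ≤ b)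
    (h : ∀ t, a ≤ t → t ≤ b → g t ≠ 0) : 0 < g a * g b := by
  by_contra hc
  push Not at hc
  have hcont : ContinuousOn g (Set.Icc a b) := by
    have : g = fun t => α + β * t := funext hg
    rw [this]; fun_prop
  rcases le_or_gt (g a) 0 with h1 | h1
  · have h2 : 0 ≤ g b := by
      by_contra h3
      push Not at h3
      have h4 : g a < 0 := lt_of_le_of_ne h1 (h a le_rfl hab)
      nlinarith
    obtain ⟨t, ht, h0⟩ := intermediate_value_Icc hab hcont ⟨h1, h2⟩
    exact h t ht.1 ht.2 h0
  · have h2 : g b ≤ 0 := by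
      by_contra h3
      push Not at h3
      nlinarith
    obtain ⟨t, ht, h0⟩ := intermediate_value_Icc' hab hcont ⟨h2, h1.le⟩
    exact h t ht.1 ht.2 h0

/-- propagation of freeness to the next event. -/
theorem key (hC : C.Ok) {σ τ f : Pt × Pt} {t t' : ℝ} (hσ : C.adm σ) (hτ : C.adm τ)
    (hσ1 : C.X (C.lo σ) ≤ t') (hσ2 : t ≤ C.X (C.hi σ))
    (hτ1 : C.X (C.lo τ) ≤ t') (hτ2 : t ≤ C.X (C.hi τ)) (htt : t' < t)
    (hno : ∀ w ∈ C.P, C.X w < t → C.X w ≤ t') (hfree : C.free σ τ t)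
    (hf : f ∈ C.M) (hin : C.In f t') (hne : C.X (C.hi f) ≠ t') :
    0 < (C.v f t' - C.v σ t') * (C.v f t' - C.v τ t') := by
  have h1 : t ≤ C.X (C.hi f) := by
    by_contra h
    push Not at h
    have := hno _ (hC.hiP f hf) h
    exact hne (le_antisymm this hin.2)
  have h2 := hfree f hf ⟨hin.1.trans htt.le, h1⟩
  obtain ⟨a, b, hab⟩ := hC.aff f
  have sgn : ∀ ρ, C.adm ρ → C.X (C.lo ρ) ≤ t' → t ≤ C.X (C.hi ρ) →
      0 < (C.v f t' - C.v ρ t') * (C.v f t - C.v ρ t) := by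
    intro ρ hρ h3 h4
    obtain ⟨c, d, hcd⟩ := hC.aff ρ
    refine aff_sign (g := fun s => C.v f s - C.v ρ s) (α := a - c) (β := b - d) ?_ htt.le ?_
    · intro s; simp only [hab, hcd]; ring
    · intro s hs1 hs2
      exact sub_ne_zero.2 (hρ.ne f hf s ⟨hin.1.trans hs1, hs2.trans h1⟩
        ⟨h3.trans hs1, hs2.trans h4⟩)
  have h3 := sgn σ hσ hσ1 hσ2
  have h4 := sgn τ hτ hτ1 hτ2
  have h5 := mul_pos h3 h4
  have h6 : 0 < ((C.v f t' - C.v σ t') * (C.v f t' - C.v τ t')) *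
    ((C.v f t - C.v σ t) * (C.v f t - C.v τ t)) := by
    have e : ∀ a b c d : ℝ, a * b * (c * d) = a * c * (b * d) := by intros; ring
    rw [e]; exact h5
  exact (pos_iff_pos_of_mul_pos h6).2 h2

theorem sgn_aux {a b c : ℝ} (h : 0 < a * b) (h' : 0 ≤ c * b) : 0 ≤ c * a := by
  rcases lt_trichotomy b 0 with hb | hb | hb
  · have : a < 0 := by nlinarith
    have : c ≤ 0 := by nlinarith
    nlinarith
  · subst hb; simp at h
  · have : 0 < a := by nlinarith
    have : 0 ≤ c := by nlinarith
    positivity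

theorem nI_step (hC : C.Ok) {σ : Pt × Pt} {t : ℝ} {z : Pt} (hz : z ∈ C.P) (hzt : C.X z < t)
    (hno : ∀ w ∈ C.P, C.X w < t → C.X w ≤ C.X z) :
    C.nI σ t = C.nI σ (C.X z) + if C.iso z ∧ C.vis σ z then 1 else 0 := by
  unfold nI
  have key : ∀ w ∈ C.P, (C.X w < t ↔ (C.X w < C.X z ∨ w = z)) := by
    intro w hw
    constructor
    · intro h
      rcases lt_or_eq_of_le (hno w hw h) with h1 | h1
      · exact Or.inl h1
      · exact Or.inr (hC.Xinj w hw z hz h1)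
    · rintro (h | rfl)
      · exact h.trans hzt
      · exact hzt
  split_ifs with h
  · rw [← Finset.card_insert_of_notMem (a := z)]
    · congr 1
      ext w
      simp only [Finset.mem_filter, Finset.mem_insert]
      constructor
      · rintro ⟨h1, h2, h3, h4⟩
        rcases (key w h1).1 h4 with h5 | h5
        · exact Or.inr ⟨h1, h2, h3, h5⟩
        · exact Or.inl h5
      · rintro (rfl | ⟨h1, h2, h3, h4⟩)
        · exact ⟨hz, h.1, h.2, hzt⟩
        · exact ⟨h1, h2, h3, h4.trans hzt⟩
    · simp
  · rw [add_zero]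
    congr 1
    ext w
    simp only [Finset.mem_filter]
    constructor
    · rintro ⟨h1, h2, h3, h4⟩
      rcases (key w h1).1 h4 with h5 | h5
      · exact ⟨h1, h2, h3, h5⟩
      · subst h5; exact absurd ⟨h2, h3⟩ h
    · rintro ⟨h1, h2, h3, h4⟩
      exact ⟨h1, h2, h3, h4.trans hzt⟩

theorem nR_step (hC : C.Ok) {σ : Pt × Pt} {t : ℝ} {z : Pt} (hz : z ∈ C.P) (hzt : C.X z < t)
    (hno : ∀ w ∈ C.P, C.X w < t → C.X w ≤ C.X z) :
    C.nR σ t = C.nR σ (C.X z) + if C.isHi z ∧ C.vis σ z then 1 else 0 := by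
  unfold nR
  have key : ∀ w ∈ C.P, (C.X w < t ↔ (C.X w < C.X z ∨ w = z)) := by
    intro w hw
    constructor
    · intro h
      rcases lt_or_eq_of_le (hno w hw h) with h1 | h1
      · exact Or.inl h1
      · exact Or.inr (hC.Xinj w hw z hz h1)
    · rintro (h | rfl)
      · exact h.trans hzt
      · exact hzt
  split_ifs with h
  · rw [← Finset.card_insert_of_notMem (a := z)]
    · congr 1
      ext w
      simp only [Finset.mem_filter, Finset.mem_insert]
      constructor
      · rintro ⟨h1, h2, h3, h4⟩
        rcases (key w h1).1 h4 with h5 | h5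
        · exact Or.inr ⟨h1, h2, h3, h5⟩
        · exact Or.inl h5
      · rintro (rfl | ⟨h1, h2, h3, h4⟩)
        · exact ⟨hz, h.1, h.2, hzt⟩
        · exact ⟨h1, h2, h3, h4.trans hzt⟩
    · simp
  · rw [add_zero]
    congr 1
    ext w
    simp only [Finset.mem_filter]
    constructor
    · rintro ⟨h1, h2, h3, h4⟩
      rcases (key w h1).1 h4 with h5 | h5
      · exact ⟨h1, h2, h3, h5⟩
      · subst h5; exact absurd ⟨h2, h3⟩ h
    · rintro ⟨h1, h2, h3, h4⟩
      exact ⟨h1, h2, h3, h4.trans hzt⟩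

/-- visibility transfers between members of a bundle. -/
theorem vis_transfer (hC : C.Ok) {T : Finset (Pt × Pt)} {t : ℝ} (hT : C.Bun T t) {z : Pt}
    (hz : z ∈ C.P) (hzt : C.X z < t) (hno : ∀ w ∈ C.P, C.X w < t → C.X w ≤ C.X z)
    {σ τ : Pt × Pt} (hσ : σ ∈ T) (hτ : τ ∈ T) (hσz : C.lo σ ≠ z)
    (h : C.vis τ z ∨ C.lo τ = z) : C.vis σ z := by
  obtain ⟨aσ, lσ, rσ, fσ⟩ := hT σ hσ
  obtain ⟨aτ, lτ, rτ, -⟩ := hT τ hτ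
  have h1 := hno _ aσ.loP lσ
  have h2 := hno _ aτ.loP lτ
  have h1' : C.X (C.lo σ) < C.X z := lt_of_le_of_ne h1 fun h => hσz (hC.Xinj _ aσ.loP _ hz h)
  refine ⟨h1', hzt.trans_le rσ, ?_⟩
  intro f hf hin
  by_cases hfz : C.hi f = z
  · have := hC.vhi f (hC.lt f hf)
    rw [hfz] at this
    rw [this]; simp
  have hk := key hC aσ aτ h1 rσ h2 rτ hzt hno (fσ τ hτ) hf hin
    (fun h => hfz (hC.Xinj _ (hC.hiP f hf) _ hz h))
  refine sgn_aux hk ?_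
  rcases h with h | h
  · exact h.2.2 f hf hin
  · have := hC.vlo τ aτ.lt
    rw [h] at this
    rw [this]; exact mul_self_nonneg _

theorem not_FR_of_no {σ : Pt × Pt} {t : ℝ} (hσ : ∀ w ∈ C.P, C.X w < t → C.X w ≤ C.X (C.lo σ)) :
    ¬ C.FR σ t := by
  rintro ⟨q, hq, -, h1, h2, -⟩
  exact absurd (hσ q hq h2) (not_le.2 h1.1)

theorem FR_skip {σ : Pt × Pt} {t : ℝ} {z : Pt} (hC : C.Ok) (hz : z ∈ C.P) (hzt : C.X z < t)
    (hno : ∀ w ∈ C.P, C.X w < t → C.X w ≤ C.X z)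
    (hv : (C.iso z ∨ C.isHi z) → ¬ C.vis σ z) : C.FR σ t ↔ C.FR σ (C.X z) := by
  constructor
  · rintro ⟨q, hq, h1, h2, h3, h4⟩
    refine ⟨q, hq, h1, h2, ?_, fun w hw a b c => h4 w hw a (b.trans hzt) c⟩
    refine lt_of_le_of_ne (hno q hq h3) fun h => ?_
    have := hC.Xinj _ hq _ hz h
    subst this
    exact hv (Or.inr h1) h2
  · rintro ⟨q, hq, h1, h2, h3, h4⟩
    refine ⟨q, hq, h1, h2, h3.trans hzt, fun w hw a b c => ?_⟩
    rcases lt_or_eq_of_le (hno w hw b) with h | h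
    · exact h4 w hw a h c
    · have := hC.Xinj _ hw _ hz h
      subst this
      exact absurd a (hv c)

theorem bun_ind (hC : C.Ok) (motive : Finset (Pt × Pt) → ℝ → Prop)
    (hempty : ∀ t, motive ∅ t)
    (hskip : ∀ T t t', C.Bun T t' →
      (∀ σ ∈ T, C.nI σ t = C.nI σ t' ∧ C.nR σ t = C.nR σ t' ∧ (C.FR σ t ↔ C.FR σ t')) →
      motive T t' → motive T t)
    (hiso : ∀ T t z, z ∈ C.P → C.iso z → C.Bun (T.filter fun σ => C.lo σ ≠ z) (C.X z) →
      (∀ τ, C.adm τ → C.hi τ = z →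
        C.Bun (insert τ (T.filter fun σ => C.lo σ ≠ z)) (C.X z)) →
      (∀ σ ∈ T, C.lo σ ≠ z → C.nI σ t = C.nI σ (C.X z) + 1 ∧ C.nR σ t = C.nR σ (C.X z)) →
      (∀ σ ∈ T, C.lo σ = z → C.nI σ t = 0 ∧ C.nR σ t = 0) →
      (∀ σ ∈ T, ¬ C.FR σ t) →
      motive (T.filter fun σ => C.lo σ ≠ z) (C.X z) → motive T t)
    (hbr : ∀ T t t' (p : Pt × Pt → Prop), C.Bun (T.filter p) t' →
      C.Bun (T.filter fun σ => ¬ p σ) t' →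
      (∀ σ ∈ T, C.nI σ t = C.nI σ t' ∧ C.nR σ t = C.nR σ t' + 1 ∧ C.FR σ t) →
      motive (T.filter p) t' → motive (T.filter fun σ => ¬ p σ) t' → motive T t) :
    ∀ T t, C.Bun T t → motive T t := by
  have main : ∀ n : ℕ, ∀ T t, (C.P.filter fun w => C.X w < t).card = n → C.Bun T t → motive T t := by
    intro n
    induction n using Nat.strong_induction_on with
    | _ n ih =>
    intro T t hn hT
    rcases T.eq_empty_or_nonempty with rfl | ⟨σ₀, hσ₀⟩
    · exact hempty t
    have hne : (C.P.filter fun w => C.X w < t).Nonempty :=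
      ⟨C.lo σ₀, Finset.mem_filter.2 ⟨(hT σ₀ hσ₀).1.loP, (hT σ₀ hσ₀).2.1⟩⟩
    obtain ⟨z, hz', hmax⟩ := Finset.exists_max_image _ C.X hne
    obtain ⟨hz, hzt⟩ := Finset.mem_filter.1 hz'
    have hno : ∀ w ∈ C.P, C.X w < t → C.X w ≤ C.X z := fun w hw h =>
      hmax w (Finset.mem_filter.2 ⟨hw, h⟩)
    have hlt : (C.P.filter fun w => C.X w < C.X z).card < n := by
      rw [← hn]
      apply Finset.card_lt_card
      refine ⟨fun w hw => ?_, fun h => ?_⟩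
      · obtain ⟨h1, h2⟩ := Finset.mem_filter.1 hw
        exact Finset.mem_filter.2 ⟨h1, h2.trans hzt⟩
      · exact absurd (Finset.mem_filter.1 (h hz')).2 (lt_irrefl _)
    have IH : ∀ T', C.Bun T' (C.X z) → motive T' (C.X z) := fun T' h => ih _ hlt T' _ rfl h
    have hlo : ∀ σ ∈ T, C.lo σ ≠ z → C.X (C.lo σ) < C.X z := fun σ hσ h =>
      lt_of_le_of_ne (hno _ (hT σ hσ).1.loP (hT σ hσ).2.1)
        fun h' => h (hC.Xinj _ (hT σ hσ).1.loP _ hz h')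
    have hlo' : ∀ σ ∈ T, C.X (C.lo σ) ≤ C.X z := fun σ hσ =>
      hno _ (hT σ hσ).1.loP (hT σ hσ).2.1
    -- freeness of sub-bundles
    have hfree : ∀ σ ∈ T, ∀ τ ∈ T, (∀ f ∈ C.M, C.hi f = z →
        0 < (z.2 - C.v σ (C.X z)) * (z.2 - C.v τ (C.X z))) → C.free σ τ (C.X z) := by
      intro σ hσ τ hτ hz2 f hf hin
      by_cases hfz : C.hi f = z
      · have := hC.vhi f (hC.lt f hf)
        rw [hfz] at this
        rw [this]; exact hz2 f hf hfz
      · exact key hC (hT σ hσ).1 (hT τ hτ).1 (hlo' σ hσ) (hT σ hσ).2.2.1 (hlo' τ hτ)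
          (hT τ hτ).2.2.1 hzt hno ((hT σ hσ).2.2.2 τ hτ) hf hin
          (fun h => hfz (hC.Xinj _ (hC.hiP f hf) _ hz h))
    have hsub : ∀ T' ⊆ T, (∀ σ ∈ T', C.lo σ ≠ z) → (∀ σ ∈ T', ∀ τ ∈ T', ∀ f ∈ C.M, C.hi f = z →
        0 < (z.2 - C.v σ (C.X z)) * (z.2 - C.v τ (C.X z))) → C.Bun T' (C.X z) := by
      intro T' hsub h1 h2 σ hσ
      have hσT := hsub hσ
      exact ⟨(hT σ hσT).1, hlo σ hσT (h1 σ hσ), hzt.le.trans (hT σ hσT).2.2.1,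
        fun τ hτ => hfree σ hσT τ (hsub hτ) (h2 σ hσ τ hτ)⟩
    have nIs := fun σ => nI_step (σ := σ) hC hz hzt hno
    have nRs := fun σ => nR_step (σ := σ) hC hz hzt hno
    by_cases hI : C.iso z
    · have hnh := iso_not_hi hI
      by_cases hv : ∃ τ ∈ T, C.vis τ z ∨ C.lo τ = z
      · -- isolated event
        obtain ⟨τ, hτ, hτz⟩ := hv
        have hB : C.Bun (T.filter fun σ => C.lo σ ≠ z) (C.X z) := by
          refine hsub _ (Finset.filter_subset _ _) (fun σ hσ => (Finset.mem_filter.1 hσ).2) ?_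
          intro _ _ _ _ f hf hfz
          exact absurd ⟨f, hf, hfz⟩ hnh
        have hvis : ∀ σ ∈ T, C.lo σ ≠ z → C.vis σ z := fun σ hσ h =>
          vis_transfer hC hT hz hzt hno hσ hτ h hτz
        refine hiso T t z hz hI hB ?_ ?_ ?_ ?_ (IH _ hB)
        · intro τ' aτ' hτ'
          have hval : C.v τ' (C.X z) = z.2 := by
            have := hC.vhi τ' aτ'.lt
            rwa [hτ'] at this
          have hfz : ∀ f ∈ C.M, C.In f (C.X z) → C.v f (C.X z) - z.2 ≠ 0 := by
            intro f hf hin h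
            rcases hC.gp f hf z hz hin (sub_eq_zero.1 h) with h1 | h1
            · exact (hI f hf).1 h1.symm
            · exact (hI f hf).2 h1.symm
          have hfr : ∀ σ ∈ T.filter (fun σ => C.lo σ ≠ z), ∀ f ∈ C.M, C.In f (C.X z) →
              0 < (C.v f (C.X z) - z.2) * (C.v f (C.X z) - C.v σ (C.X z)) := by
            intro σ hσ f hf hin
            obtain ⟨hσT, hσz⟩ := Finset.mem_filter.1 hσ
            refine lt_of_le_of_ne ((hvis σ hσT hσz).2.2 f hf hin) (Ne.symm (mul_ne_zero (hfz f hf hin) ?_))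
            exact sub_ne_zero.2 ((hT σ hσT).1.ne f hf _ hin
              ⟨hlo' σ hσT, hzt.le.trans (hT σ hσT).2.2.1⟩)
          intro σ hσ
          rcases Finset.mem_insert.1 hσ with hσ2 | hσ2
          · rw [hσ2]
            refine ⟨aτ', by rw [← hτ']; exact aτ'.lt, by rw [hτ'], ?_⟩
            intro ρ hρ f hf hin
            rw [hval]
            rcases Finset.mem_insert.1 hρ with hρ2 | hρ2
            · rw [hρ2, hval]; exact mul_self_pos.2 (hfz f hf hin)
            · exact hfr ρ hρ2 f hf hin
          · refine ⟨(hB σ hσ2).1, (hB σ hσ2).2.1, (hB σ hσ2).2.2.1, ?_⟩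
            intro ρ hρ
            rcases Finset.mem_insert.1 hρ with hρ2 | hρ2
            · intro f hf hin
              rw [hρ2, hval, mul_comm]; exact hfr σ hσ2 f hf hin
            · exact (hB σ hσ2).2.2.2 ρ hρ2
        · intro σ hσ hσz
          rw [nIs, nRs, if_pos ⟨hI, hvis σ hσ hσz⟩, if_neg (fun h => hnh h.1)]
          exact ⟨rfl, rfl⟩
        · intro σ hσ hσz
          unfold nI nR
          simp only [Finset.card_eq_zero, Finset.filter_eq_empty_iff]
          constructor
          · rintro w hw ⟨-, h1, h2⟩
            have := hno w hw h2
            rw [← hσz] at this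
            exact absurd this (not_le.2 h1.1)
          · rintro w hw ⟨-, h1, h2⟩
            have := hno w hw h2
            rw [← hσz] at this
            exact absurd this (not_le.2 h1.1)
        · intro σ hσ
          by_cases hσz : C.lo σ = z
          · exact not_FR_of_no (by rw [hσz]; exact hno)
          · rintro ⟨q, hq, h1, h2, h3, h4⟩
            have h5 := h4 z hz (hvis σ hσ hσz) hzt (Or.inl hI)
            have h6 := hC.Xinj _ hq _ hz (le_antisymm (hno q hq h3) h5)
            subst h6
            exact hnh h1
      · push Not at hv
        have hB : C.Bun T (C.X z) := by
          refine hsub _ (Finset.Subset.refl _) (fun σ hσ => (hv σ hσ).2) ?_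
          intro _ _ _ _ f hf hfz
          exact absurd ⟨f, hf, hfz⟩ hnh
        refine hskip T t _ hB ?_ (IH _ hB)
        intro σ hσ
        rw [nIs, nRs, if_neg (fun h => (hv σ hσ).1 h.2), if_neg (fun h => hnh h.1)]
        exact ⟨rfl, rfl, FR_skip hC hz hzt hno (fun _ => (hv σ hσ).1)⟩
    · have hloz : ∀ σ ∈ T, C.lo σ ≠ z := fun σ hσ h => hI (h ▸ (hT σ hσ).1.iso_lo)
      by_cases hH : C.isHi z
      · obtain ⟨e, he, hez⟩ := hH
        have hH : C.isHi z := ⟨e, he, hez⟩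
        have hve : C.v e (C.X z) = z.2 := by
          have := hC.vhi e (hC.lt e he)
          rwa [hez] at this
        have hine : C.In e (C.X z) := by
          rw [← hez]; exact ⟨(hC.lt e he).le, le_rfl⟩
        have hnz : ∀ σ ∈ T, z.2 - C.v σ (C.X z) ≠ 0 := by
          intro σ hσ
          rw [← hve]
          exact sub_ne_zero.2 ((hT σ hσ).1.ne e he _ hine
              ⟨hlo' σ hσ, hzt.le.trans (hT σ hσ).2.2.1⟩)
        by_cases hv : ∃ τ ∈ T, C.vis τ z
        · obtain ⟨τ, hτ, hτz⟩ := hv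
          have hvis : ∀ σ ∈ T, C.vis σ z := fun σ hσ =>
            vis_transfer hC hT hz hzt hno hσ hτ (hloz σ hσ) (Or.inl hτz)
          have hB1 : C.Bun (T.filter fun σ => 0 < z.2 - C.v σ (C.X z)) (C.X z) := by
            refine hsub _ (Finset.filter_subset _ _)
              (fun σ hσ => hloz σ (Finset.mem_filter.1 hσ).1) ?_
            intro σ hσ ρ hρ _ _ _
            exact mul_pos (Finset.mem_filter.1 hσ).2 (Finset.mem_filter.1 hρ).2
          have hB2 : C.Bun (T.filter fun σ => ¬ 0 < z.2 - C.v σ (C.X z)) (C.X z) := by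
            refine hsub _ (Finset.filter_subset _ _)
              (fun σ hσ => hloz σ (Finset.mem_filter.1 hσ).1) ?_
            intro σ hσ ρ hρ _ _ _
            obtain ⟨a1, a2⟩ := Finset.mem_filter.1 hσ
            obtain ⟨b1, b2⟩ := Finset.mem_filter.1 hρ
            exact mul_pos_of_neg_of_neg (lt_of_le_of_ne (not_lt.1 a2) (hnz σ a1))
              (lt_of_le_of_ne (not_lt.1 b2) (hnz ρ b1))
          refine hbr T t _ _ hB1 hB2 ?_ (IH _ hB1) (IH _ hB2)
          intro σ hσ
          rw [nIs, nRs, if_neg (fun h => hI h.1), if_pos ⟨hH, hvis σ hσ⟩]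
          exact ⟨rfl, rfl, z, hz, hH, hvis σ hσ, hzt, fun w hw _ h _ => hno w hw h⟩
        · push Not at hv
          have hB : C.Bun T (C.X z) := by
            refine hsub _ (Finset.Subset.refl _) hloz ?_
            intro σ hσ τ hτ _ _ _
            by_contra hc
            apply hv σ hσ
            refine ⟨hlo σ hσ (hloz σ hσ), hzt.trans_le (hT σ hσ).2.2.1, ?_⟩
            intro f hf hin
            by_cases hfz : C.hi f = z
            · have := hC.vhi f (hC.lt f hf)
              rw [hfz] at this
              rw [this]; simp
            have hk := key hC (hT σ hσ).1 (hT τ hτ).1 (hlo' σ hσ) (hT σ hσ).2.2.1 (hlo' τ hτ)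
              (hT τ hτ).2.2.1 hzt hno ((hT σ hσ).2.2.2 τ hτ) hf hin
              (fun h => hfz (hC.Xinj _ (hC.hiP f hf) _ hz h))
            push Not at hc
            by_contra hneg
            push Not at hneg
            rcases lt_or_gt_of_ne (hnz σ hσ) with h1 | h1
            · have h2 : 0 ≤ z.2 - C.v τ (C.X z) := by nlinarith
              have h3 : C.v f (C.X z) - C.v σ (C.X z) < 0 := by nlinarith
              have h4 : 0 < C.v f (C.X z) - z.2 := by nlinarith
              have h5 : 0 < C.v f (C.X z) - C.v τ (C.X z) := by linarith
              linarith [mul_neg_of_neg_of_pos h3 h5]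
            · have h2 : z.2 - C.v τ (C.X z) ≤ 0 := by nlinarith
              have h3 : 0 < C.v f (C.X z) - C.v σ (C.X z) := by nlinarith
              have h4 : C.v f (C.X z) - z.2 < 0 := by nlinarith
              have h5 : C.v f (C.X z) - C.v τ (C.X z) < 0 := by linarith
              linarith [mul_neg_of_pos_of_neg h3 h5]
          refine hskip T t _ hB ?_ (IH _ hB)
          intro σ hσ
          rw [nIs, nRs, if_neg (fun h => hI h.1), if_neg (fun h => hv σ hσ h.2)]
          exact ⟨rfl, rfl, FR_skip hC hz hzt hno (fun _ => hv σ hσ)⟩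
      · have hB : C.Bun T (C.X z) := by
          refine hsub _ (Finset.Subset.refl _) hloz ?_
          intro _ _ _ _ f hf hfz
          exact absurd ⟨f, hf, hfz⟩ hH
        refine hskip T t _ hB ?_ (IH _ hB)
        intro σ hσ
        rw [nIs, nRs, if_neg (fun h => hI h.1), if_neg (fun h => hH h.1)]
        exact ⟨rfl, rfl, FR_skip hC hz hzt hno (fun h => (h.elim hI hH).elim)⟩
  exact fun T t hT => main _ T t rfl hT

theorem sum_split_lo {S : Finset (Pt × Pt)} (hS : Set.InjOn C.lo (S : Set (Pt × Pt))) (z : Pt)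
    (w : Pt × Pt → ℕ) :
    (∑ σ ∈ S, w σ = ∑ σ ∈ S.filter (fun σ => C.lo σ ≠ z), w σ) ∨
    ∃ σ ∈ S, C.lo σ = z ∧
      ∑ σ ∈ S, w σ = w σ + ∑ σ ∈ S.filter (fun σ => C.lo σ ≠ z), w σ := by
  by_cases h : ∃ σ ∈ S, C.lo σ = z
  · right
    obtain ⟨σ, hσ, hz⟩ := h
    refine ⟨σ, hσ, hz, ?_⟩
    have : S.filter (fun σ => C.lo σ ≠ z) = S.erase σ := by
      ext τ
      simp only [Finset.mem_filter, Finset.mem_erase]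
      constructor
      · rintro ⟨h1, h2⟩
        exact ⟨fun h => h2 (h ▸ hz), h1⟩
      · rintro ⟨h1, h2⟩
        exact ⟨h2, fun h => h1 (hS h2 hσ (h.trans hz.symm))⟩
    rw [this, Finset.add_sum_erase _ _ hσ]
  · left
    push Not at h
    rw [Finset.filter_true_of_mem h]

theorem filter_sub {S T : Finset (Pt × Pt)} (h : S ⊆ T) (p : Pt × Pt → Prop) [DecidablePred p] :
    S.filter p ⊆ T.filter p := Finset.filter_subset_filter p h

theorem inj_filter {S : Finset (Pt × Pt)} (hS : Set.InjOn C.lo (S : Set (Pt × Pt)))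
    (p : Pt × Pt → Prop) [DecidablePred p] : Set.InjOn C.lo ((S.filter p : Finset (Pt × Pt)) : Set (Pt × Pt)) :=
  hS.mono (by exact_mod_cast Finset.filter_subset p S)

/-- basic tree bound -/
def fb : ℕ → ℕ
  | 0 => 0
  | (k + 1) => max (k + 1 + fb k) (2 * fb k)

theorem sum_F (hC : C.Ok) : ∀ T t, C.Bun T t → ∀ S ⊆ T, Set.InjOn C.lo (S : Set (Pt × Pt)) →
    ∀ k : ℕ, ∑ σ ∈ S, (k - (C.nI σ t + C.nR σ t)) ≤ fb k := by
  refine bun_ind hC _ ?_ ?_ ?_ ?_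
  · intro t S hS _ k
    rw [Finset.subset_empty.1 hS]; simp
  · intro T t t' _ heq ih S hS hi k
    rw [Finset.sum_congr rfl (fun σ hσ => by rw [(heq σ (hS hσ)).1, (heq σ (hS hσ)).2.1])]
    exact ih S hS hi k
  · intro T t z _ _ _ _ h1 h2 _ ih S hS hi k
    rcases k with _ | k
    · simp
    have h3 : ∑ σ ∈ S.filter (fun σ => C.lo σ ≠ z), (k + 1 - (C.nI σ t + C.nR σ t)) ≤ fb k := by
      refine le_trans (le_of_eq (Finset.sum_congr rfl fun σ hσ => ?_)) (ih _ (filter_sub hS (fun σ => C.lo σ ≠ z)) (inj_filter hi _) k)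
      obtain ⟨a, b⟩ := Finset.mem_filter.1 hσ
      obtain ⟨c, d⟩ := h1 σ (hS a) b
      omega
    have h4 : k + 1 + fb k ≤ fb (k + 1) := le_max_left _ _
    rcases sum_split_lo hi z (fun σ => k + 1 - (C.nI σ t + C.nR σ t)) with h5 | ⟨σ, -, -, h5⟩
    · rw [h5]; omega
    · rw [h5]; omega
  · intro T t t' p _ _ h1 ih1 ih2 S hS hi k
    rcases k with _ | k
    · simp
    have h3 := ih1 _ (filter_sub hS _) (inj_filter hi _) k
    have h4 := ih2 _ (filter_sub hS (fun σ => ¬ p σ)) (inj_filter hi _) k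
    have h5 : 2 * fb k ≤ fb (k + 1) := le_max_right _ _
    rw [Finset.sum_congr rfl (fun σ hσ => show k + 1 - (C.nI σ t + C.nR σ t) =
      k - (C.nI σ t' + C.nR σ t') by have := h1 σ (hS hσ); omega),
      ← Finset.sum_filter_add_sum_filter_not S p]
    refine (add_le_add h3 h4).trans ?_
    omega

theorem sum_FR (hC : C.Ok) : ∀ T t, C.Bun T t → (∃ τ ∈ T, C.FR τ t) → ∀ S ⊆ T,
    Set.InjOn C.lo (S : Set (Pt × Pt)) →
    ∀ k : ℕ, ∑ σ ∈ S, (k - (C.nI σ t + C.nR σ t)) ≤ 2 * fb (k - 1) := by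
  refine bun_ind hC _ ?_ ?_ ?_ ?_
  · rintro t ⟨τ, hτ, -⟩
    simp at hτ
  · rintro T t t' _ heq ih ⟨τ, hτ, hF⟩ S hS hi k
    rw [Finset.sum_congr rfl (fun σ hσ => by rw [(heq σ (hS hσ)).1, (heq σ (hS hσ)).2.1])]
    exact ih ⟨τ, hτ, (heq τ hτ).2.2.1 hF⟩ S hS hi k
  · rintro T t z _ _ _ _ h1 h2 h3 ih ⟨τ, hτ, hF⟩
    exact absurd hF (h3 τ hτ)
  · intro T t t' p hB1 hB2 h1 ih1 ih2 _ S hS hi k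
    rcases k with _ | k
    · simp
    have h3 := sum_F hC _ _ hB1 _ (filter_sub hS _) (inj_filter hi _) k
    have h4 := sum_F hC _ _ hB2 _ (filter_sub hS (fun σ => ¬ p σ)) (inj_filter hi _) k
    rw [Finset.sum_congr rfl (fun σ hσ => show k + 1 - (C.nI σ t + C.nR σ t) =
      k - (C.nI σ t' + C.nR σ t') by have := h1 σ (hS hσ); omega),
      ← Finset.sum_filter_add_sum_filter_not S p]
    refine (add_le_add h3 h4).trans ?_
    simp only [Nat.add_sub_cancel]
    omega

/-- bound for the part after an isolated event -/
theorem sum_rest (hC : C.Ok) {T : Finset (Pt × Pt)} {t : ℝ} {z : Pt}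
    (hB : C.Bun (T.filter fun σ => C.lo σ ≠ z) (C.X z))
    (hB' : ∀ τ, C.adm τ → C.hi τ = z → C.Bun (insert τ (T.filter fun σ => C.lo σ ≠ z)) (C.X z))
    (h1 : ∀ σ ∈ T, C.lo σ ≠ z → C.nI σ t = C.nI σ (C.X z) + 1 ∧ C.nR σ t = C.nR σ (C.X z))
    {S : Finset (Pt × Pt)} (hS : S ⊆ T) (hi : Set.InjOn C.lo (S : Set (Pt × Pt)))
    (w : Pt × Pt → ℕ) (k : ℕ)
    (hw : ∀ σ ∈ T, C.nI σ t ≠ 0 → w σ = 2 * (k - (C.nI σ t + C.nR σ t))) :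
    ∑ σ ∈ S.filter (fun σ => C.lo σ ≠ z), w σ ≤ 2 * fb (k - 1) ∧
    (C.LH z → ∑ σ ∈ S.filter (fun σ => C.lo σ ≠ z), w σ ≤ 4 * fb (k - 2)) := by
  have e : ∑ σ ∈ S.filter (fun σ => C.lo σ ≠ z), w σ =
      2 * ∑ σ ∈ S.filter (fun σ => C.lo σ ≠ z), (k - 1 - (C.nI σ (C.X z) + C.nR σ (C.X z))) := by
    rw [Finset.mul_sum]
    refine Finset.sum_congr rfl fun σ hσ => ?_
    obtain ⟨a, b⟩ := Finset.mem_filter.1 hσ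
    obtain ⟨c, d⟩ := h1 σ (hS a) b
    rw [hw σ (hS a) (by omega)]
    omega
  constructor
  · have := sum_F hC _ _ hB _ (filter_sub hS (fun σ => C.lo σ ≠ z)) (inj_filter hi _) (k - 1)
    omega
  · rintro ⟨τ, ha, hh, hF⟩
    have := sum_FR hC _ _ (hB' τ ha hh) ⟨τ, Finset.mem_insert_self _ _, hF⟩
      (S.filter fun σ => C.lo σ ≠ z)
      ((filter_sub hS (fun σ => C.lo σ ≠ z)).trans (Finset.subset_insert _ _)) (inj_filter hi _) (k - 1)
    have e2 : k - 1 - 1 = k - 2 := by omega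
    rw [e2] at this
    omega

/-- weights at a heavy point -/
noncomputable def WG (C : Cfg) (Hv : Pt → Prop) (k : ℕ) (t : ℝ) (σ : Pt × Pt) : ℕ :=
  2 * (k - (C.nI σ t + C.nR σ t)) - (if C.nI σ t = 0 ∧ C.nR σ t < k ∧ ¬ Hv (C.lo σ) then 1 else 0)

/-- weights at a light point -/
noncomputable def WH (C : Cfg) (Hv : Pt → Prop) (k : ℕ) (t : ℝ) (σ : Pt × Pt) : ℕ :=
  2 * (k - (C.nI σ t + C.nR σ t)) + (if C.nI σ t = 0 ∧ C.nR σ t ≤ k ∧ Hv (C.lo σ) then 1 else 0)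

def gb : ℕ → ℕ
  | 0 => 0
  | (k + 1) => max (2 * gb k) (max (2 * k + 1 + 2 * fb k) (2 * k + 2 + 4 * fb (k - 1)))

def hb : ℕ → ℕ
  | 0 => 1
  | (k + 1) => max (2 * hb k) (max (2 * k + 2 + 2 * fb k) (2 * k + 3 + 4 * fb (k - 1)))

theorem sum_G (hC : C.Ok) (Hv : Pt → Prop) (hHv : ∀ z, Hv z → C.LH z) :
    ∀ T t, C.Bun T t → ∀ S ⊆ T, Set.InjOn C.lo (S : Set (Pt × Pt)) →
    ∀ k : ℕ, ∑ σ ∈ S, C.WG Hv k t σ ≤ gb k := by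
  refine bun_ind hC _ ?_ ?_ ?_ ?_
  · intro t S hS _ k
    rw [Finset.subset_empty.1 hS]; simp
  · intro T t t' _ heq ih S hS hi k
    rw [Finset.sum_congr rfl (fun σ hσ => show C.WG Hv k t σ = C.WG Hv k t' σ by
      unfold WG; rw [(heq σ (hS hσ)).1, (heq σ (hS hσ)).2.1])]
    exact ih S hS hi k
  · intro T t z _ _ hB hB' h1 h2 _ ih S hS hi k
    rcases k with _ | k
    · simp [WG]
    obtain ⟨r1, r2⟩ := sum_rest hC hB hB' h1 hS hi (C.WG Hv (k + 1) t) (k + 1)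
      (fun σ _ h => by unfold WG; simp [h])
    have e2 : k + 1 - 2 = k - 1 := by omega
    rw [e2] at r2
    simp only [Nat.add_sub_cancel] at r1
    have g1 : 2 * k + 1 + 2 * fb k ≤ gb (k + 1) := (le_max_left _ _).trans (le_max_right _ _)
    have g2 : 2 * k + 2 + 4 * fb (k - 1) ≤ gb (k + 1) := (le_max_right _ _).trans (le_max_right _ _)
    rcases sum_split_lo hi z (C.WG Hv (k + 1) t) with h5 | ⟨σ, hσ, hz, h5⟩
    · rw [h5]; omega
    · rw [h5]
      obtain ⟨n1, n2⟩ := h2 σ (hS hσ) hz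
      by_cases hh : Hv z
      · have h6 := r2 (hHv z hh)
        have : C.WG Hv (k + 1) t σ ≤ 2 * (k + 1) := by unfold WG; omega
        omega
      · have : C.WG Hv (k + 1) t σ = 2 * (k + 1) - 1 := by
          unfold WG; rw [n1, n2, hz]; simp [hh]
        omega
  · intro T t t' p _ _ h1 ih1 ih2 S hS hi k
    rcases k with _ | k
    · simp [WG]
    have h3 := ih1 _ (filter_sub hS _) (inj_filter hi _) k
    have h4 := ih2 _ (filter_sub hS (fun σ => ¬ p σ)) (inj_filter hi _) k
    have h5 : 2 * gb k ≤ gb (k + 1) := le_max_left _ _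
    rw [Finset.sum_congr rfl (fun σ hσ => show C.WG Hv (k + 1) t σ = C.WG Hv k t' σ by
        obtain ⟨a, b, -⟩ := h1 σ (hS hσ)
        unfold WG
        rw [a, b, ← add_assoc, Nat.add_sub_add_right]; simp only [add_lt_add_iff_right]),
      ← Finset.sum_filter_add_sum_filter_not S p]
    refine (add_le_add h3 h4).trans ?_
    omega

theorem sum_H_iso (hC : C.Ok) (Hv : Pt → Prop) (hHv : ∀ z, Hv z → C.LH z)
    {T : Finset (Pt × Pt)} {t : ℝ} {z : Pt}
    (hB : C.Bun (T.filter fun σ => C.lo σ ≠ z) (C.X z))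
    (hB' : ∀ τ, C.adm τ → C.hi τ = z → C.Bun (insert τ (T.filter fun σ => C.lo σ ≠ z)) (C.X z))
    (h1 : ∀ σ ∈ T, C.lo σ ≠ z → C.nI σ t = C.nI σ (C.X z) + 1 ∧ C.nR σ t = C.nR σ (C.X z))
    (h2 : ∀ σ ∈ T, C.lo σ = z → C.nI σ t = 0 ∧ C.nR σ t = 0)
    {S : Finset (Pt × Pt)} (hS : S ⊆ T) (hi : Set.InjOn C.lo (S : Set (Pt × Pt))) (k : ℕ) :
    ∑ σ ∈ S, C.WH Hv k t σ ≤ max (2 * k + 2 * fb (k - 1)) (2 * k + 1 + 4 * fb (k - 2)) := by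
  obtain ⟨r1, r2⟩ := sum_rest hC hB hB' h1 hS hi (C.WH Hv k t) k
    (fun σ _ h => by unfold WH; simp [h])
  rcases sum_split_lo hi z (C.WH Hv k t) with h5 | ⟨σ, hσ, hz, h5⟩
  · rw [h5]; omega
  · rw [h5]
    obtain ⟨n1, n2⟩ := h2 σ (hS hσ) hz
    by_cases hh : Hv z
    · have h6 := r2 (hHv z hh)
      have : C.WH Hv k t σ ≤ 2 * k + 1 := by
        unfold WH; split_ifs <;> omega
      omega
    · have : C.WH Hv k t σ = 2 * k := by
        unfold WH; rw [n1, n2, hz]; simp [hh]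
      omega

theorem sum_H (hC : C.Ok) (Hv : Pt → Prop) (hHv : ∀ z, Hv z → C.LH z) :
    ∀ T t, C.Bun T t → ∀ S ⊆ T, Set.InjOn C.lo (S : Set (Pt × Pt)) →
    ∀ k : ℕ, ∑ σ ∈ S, C.WH Hv k t σ ≤ hb k := by
  refine bun_ind hC _ ?_ ?_ ?_ ?_
  · intro t S hS _ k
    rw [Finset.subset_empty.1 hS]; simp
  · intro T t t' _ heq ih S hS hi k
    rw [Finset.sum_congr rfl (fun σ hσ => show C.WH Hv k t σ = C.WH Hv k t' σ by
      unfold WH; rw [(heq σ (hS hσ)).1, (heq σ (hS hσ)).2.1])]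
    exact ih S hS hi k
  · intro T t z _ _ hB hB' h1 h2 _ ih S hS hi k
    have := sum_H_iso hC Hv hHv hB hB' h1 h2 hS hi k
    refine this.trans ?_
    rcases k with _ | k
    · simp [hb, fb]
    · exact le_max_right _ _
  · intro T t t' p _ _ h1 ih1 ih2 S hS hi k
    rcases k with _ | k
    · refine le_trans (le_of_eq (Finset.sum_eq_zero fun σ hσ => ?_)) (Nat.zero_le _)
      obtain ⟨a, b, -⟩ := h1 σ (hS hσ)
      unfold WH
      rw [a, b]
      simp
    have h3 := ih1 _ (filter_sub hS _) (inj_filter hi _) k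
    have h4 := ih2 _ (filter_sub hS (fun σ => ¬ p σ)) (inj_filter hi _) k
    have h5 : 2 * hb k ≤ hb (k + 1) := le_max_left _ _
    rw [Finset.sum_congr rfl (fun σ hσ => show C.WH Hv (k + 1) t σ = C.WH Hv k t' σ by
        obtain ⟨a, b, -⟩ := h1 σ (hS hσ)
        unfold WH
        rw [a, b, ← add_assoc, Nat.add_sub_add_right]; simp only [add_le_add_iff_right]),
      ← Finset.sum_filter_add_sum_filter_not S p]
    refine (add_le_add h3 h4).trans ?_
    omega

theorem sum_H_nonroot (hC : C.Ok) (Hv : Pt → Prop) (hHv : ∀ z, Hv z → C.LH z) :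
    ∀ T t, C.Bun T t → (∀ σ ∈ T, ¬ C.FR σ t) → ∀ S ⊆ T, Set.InjOn C.lo (S : Set (Pt × Pt)) →
    ∑ σ ∈ S, C.WH Hv 4 t σ ≤ 21 := by
  refine bun_ind hC _ ?_ ?_ ?_ ?_
  · intro t _ S hS _
    rw [Finset.subset_empty.1 hS]; simp
  · intro T t t' _ heq ih hF S hS hi
    rw [Finset.sum_congr rfl (fun σ hσ => show C.WH Hv 4 t σ = C.WH Hv 4 t' σ by
      unfold WH; rw [(heq σ (hS hσ)).1, (heq σ (hS hσ)).2.1])]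
    exact ih (fun σ hσ h => hF σ hσ ((heq σ hσ).2.2.2 h)) S hS hi
  · intro T t z _ _ hB hB' h1 h2 _ ih hF S hS hi
    exact (sum_H_iso hC Hv hHv hB hB' h1 h2 hS hi 4).trans (by decide)
  · intro T t t' p _ _ h1 ih1 ih2 hF S hS hi
    have : S = ∅ := Finset.eq_empty_of_forall_notMem fun σ hσ => hF σ (hS hσ) (h1 σ (hS hσ)).2.2
    rw [this]; simp

end Cfg

theorem Cfg.Bun_start {C : Cfg} (hC : C.Ok) {T : Finset (Pt × Pt)} {p : Pt}
    (hT : ∀ σ ∈ T, C.adm σ ∧ C.hi σ = p) : C.Bun T (C.X p) := by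
  have hv : ∀ σ ∈ T, C.v σ (C.X p) = p.2 := by
    intro σ hσ
    have := hC.vhi σ (hT σ hσ).1.lt
    rwa [(hT σ hσ).2] at this
  intro σ hσ
  obtain ⟨ha, hp⟩ := hT σ hσ
  have hlt := ha.lt
  refine ⟨ha, by rw [← hp]; exact hlt, by rw [hp], ?_⟩
  intro τ hτ f hf hin
  have := ha.ne f hf _ hin ⟨by rw [← hp]; exact hlt.le, by rw [hp]⟩
  rw [hv τ hτ, ← hv σ hσ]
  exact mul_self_pos.2 (sub_ne_zero.2 this)

theorem Cfg.side_G {C : Cfg} (hC : C.Ok) {T : Finset (Pt × Pt)} {p : Pt}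
    (hT : ∀ σ ∈ T, C.adm σ ∧ C.hi σ = p) (hi : Set.InjOn C.lo (T : Set (Pt × Pt)))
    (Hv : Pt → Prop) (hHv : ∀ z, Hv z → C.LH z) :
    ∑ σ ∈ T, C.WG Hv 4 (C.X p) σ ≤ 22 :=
  (Cfg.sum_G hC Hv hHv T _ (Cfg.Bun_start hC hT) T (Finset.Subset.refl _) hi 4).trans (by decide)

theorem Cfg.side_H {C : Cfg} (hC : C.Ok) {T : Finset (Pt × Pt)} {p : Pt}
    (hT : ∀ σ ∈ T, C.adm σ ∧ C.hi σ = p) (hi : Set.InjOn C.lo (T : Set (Pt × Pt)))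
    (Hv : Pt → Prop) (hHv : ∀ z, Hv z → C.LH z) :
    ∑ σ ∈ T, C.WH Hv 4 (C.X p) σ ≤ 24 :=
  (Cfg.sum_H hC Hv hHv T _ (Cfg.Bun_start hC hT) T (Finset.Subset.refl _) hi 4).trans (by decide)

theorem Cfg.side_H' {C : Cfg} (hC : C.Ok) {T : Finset (Pt × Pt)} {p : Pt}
    (hT : ∀ σ ∈ T, C.adm σ ∧ C.hi σ = p) (hi : Set.InjOn C.lo (T : Set (Pt × Pt)))
    (Hv : Pt → Prop) (hHv : ∀ z, Hv z → C.LH z) (hp : ¬ C.LH p) :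
    ∑ σ ∈ T, C.WH Hv 4 (C.X p) σ ≤ 21 :=
  Cfg.sum_H_nonroot hC Hv hHv T _ (Cfg.Bun_start hC hT)
    (fun σ hσ h => hp ⟨σ, (hT σ hσ).1, (hT σ hσ).2, h⟩) T (Finset.Subset.refl _) hi

noncomputable def cL (P : Finset Pt) (M : Finset (Pt × Pt)) : Cfg :=
  ⟨P, M, Prod.fst, Prod.fst, Prod.snd, yOn⟩

noncomputable def cR (P : Finset Pt) (M : Finset (Pt × Pt)) : Cfg :=
  ⟨P, M, fun z => -z.1, Prod.snd, Prod.fst, fun e t => yOn e (-t)⟩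

theorem yOn_left (e : Pt × Pt) : yOn e e.1.1 = e.1.2 := by simp [yOn]

theorem yOn_right (e : Pt × Pt) (h : e.1.1 < e.2.1) : yOn e e.2.1 = e.2.2 := by
  have : e.2.1 - e.1.1 ≠ 0 := sub_ne_zero.2 h.ne'
  unfold yOn; field_simp; ring

theorem yOn_aff (e : Pt × Pt) : ∃ α β : ℝ, ∀ t, yOn e t = α + β * t :=
  ⟨e.1.2 - e.1.1 * ((e.2.2 - e.1.2) / (e.2.1 - e.1.1)), (e.2.2 - e.1.2) / (e.2.1 - e.1.1), by
    intro t; unfold yOn; ring⟩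

theorem yOn_gp {P : Finset Pt} (hP : GenPos P) {f : Pt × Pt} {z : Pt} (h1 : f.1 ∈ P) (h2 : f.2 ∈ P)
    (hz : z ∈ P) (hlt : f.1.1 < f.2.1) (h : yOn f z.1 = z.2) : z = f.1 ∨ z = f.2 := by
  by_contra hc
  push Not at hc
  have hne : f.1 ≠ f.2 := fun h => by rw [h] at hlt; exact lt_irrefl _ hlt
  refine hP.1 f.1 h1 z hz f.2 h2 hc.1.symm hc.2 hne ?_
  have h0 : f.2.1 - f.1.1 ≠ 0 := sub_ne_zero.2 hlt.ne'
  rw [collinear_iff_of_mem (p₀ := f.1) (by simp)]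
  refine ⟨f.2 - f.1, ?_⟩
  intro q hq
  simp only [Set.mem_insert_iff, Set.mem_singleton_iff] at hq
  rcases hq with rfl | rfl | rfl
  · exact ⟨0, by simp⟩
  · refine ⟨(q.1 - f.1.1) / (f.2.1 - f.1.1), ?_⟩
    unfold yOn at h
    ext
    · simp; field_simp; ring
    · simp; rw [← h]; ring
  · exact ⟨1, by simp⟩

theorem mem_Seg {e : Pt × Pt} {t : ℝ} (h1 : e.1.1 ≤ t) (h2 : t ≤ e.2.1) (hlt : e.1.1 < e.2.1) :
    ((t, yOn e t) : Pt) ∈ Seg e.1 e.2 := by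
  have h0 : 0 < e.2.1 - e.1.1 := sub_pos.2 hlt
  unfold Seg
  refine ⟨(e.2.1 - t) / (e.2.1 - e.1.1), (t - e.1.1) / (e.2.1 - e.1.1),
    div_nonneg (by linarith) h0.le, div_nonneg (by linarith) h0.le, ?_, ?_⟩
  · field_simp; ring
  · unfold yOn
    ext
    · simp; field_simp; ring
    · simp; field_simp; ring

theorem yOn_ne {P : Finset Pt} {M : Finset (Pt × Pt)} (hM : IsMatching P M) {e f : Pt × Pt}
    (he : e ∈ M) (hf : f ∈ M) (hef : e ≠ f) {t : ℝ} (h1 : e.1.1 ≤ t) (h2 : t ≤ e.2.1)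
    (h3 : f.1.1 ≤ t) (h4 : t ≤ f.2.1) : yOn e t ≠ yOn f t := by
  intro h
  have a := mem_Seg h1 h2 (hM.x_lt e he)
  have b := mem_Seg h3 h4 (hM.x_lt f hf)
  rw [h] at a
  have : ((t, yOn f t) : Pt) ∈ Seg e.1 e.2 ∩ Seg f.1 f.2 := ⟨a, b⟩
  rw [hM.no_cross e he f hf hef] at this
  exact this

theorem cL_Ok {P : Finset Pt} {M : Finset (Pt × Pt)} (hP : GenPos P) (hM : IsMatching P M) :
    (cL P M).Ok where
  Xinj p hp q hq h := by
    by_contra hc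
    exact hP.2 p hp q hq hc h
  loP := hM.left_mem
  hiP := hM.right_mem
  lt := hM.x_lt
  vlo e _ := yOn_left e
  vhi e h := yOn_right e h
  aff := yOn_aff
  gp f hf z hz _ h := yOn_gp hP (hM.left_mem f hf) (hM.right_mem f hf) hz (hM.x_lt f hf) h
  hihi f hf g hg h := by
    by_contra hc
    exact (hM.no_shared f hf g hg hc).2.2.2 h
  lohi f hf g hg h := by
    by_cases hc : f = g
    · subst hc
      have := hM.x_lt f hf
      have h' : f.1 = f.2 := h
      rw [h'] at this
      exact lt_irrefl _ this
    · exact (hM.no_shared f hf g hg hc).2.1 h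

theorem cR_Ok {P : Finset Pt} {M : Finset (Pt × Pt)} (hP : GenPos P) (hM : IsMatching P M) :
    (cR P M).Ok where
  Xinj p hp q hq h := by
    by_contra hc
    exact hP.2 p hp q hq hc (neg_injective h)
  loP := hM.right_mem
  hiP := hM.left_mem
  lt f hf := neg_lt_neg (hM.x_lt f hf)
  vlo e h := by
    have h' : e.1.1 < e.2.1 := neg_lt_neg_iff.1 h
    simpa [cR] using yOn_right e h'
  vhi e _ := by simpa [cR] using yOn_left e
  aff e := by
    obtain ⟨α, β, h⟩ := yOn_aff e
    exact ⟨α, -β, fun t => by simp only [cR, h]; ring⟩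
  gp f hf z hz _ h := by
    have h' : yOn f z.1 = z.2 := by simpa [cR] using h
    exact (yOn_gp hP (hM.left_mem f hf) (hM.right_mem f hf) hz (hM.x_lt f hf) h').symm
  hihi f hf g hg h := by
    by_contra hc
    exact (hM.no_shared f hf g hg hc).1 h
  lohi f hf g hg h := by
    by_cases hc : f = g
    · subst hc
      have := hM.x_lt f hf
      have h' : f.2 = f.1 := h
      rw [h'] at this
      exact lt_irrefl _ this
    · exact (hM.no_shared f hf g hg hc).2.2.1 h

theorem cL_adm {P : Finset Pt} {M : Finset (Pt × Pt)} {e : Pt × Pt}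
    (hM : IsMatching P (insert e M)) (he : e ∉ M) : (cL P M).adm e := by
  have h0 := Finset.mem_insert_self e M
  have hne : ∀ f ∈ M, f ≠ e := fun f hf h => he (h ▸ hf)
  have hin : ∀ f ∈ M, f ∈ insert e M := fun f hf => Finset.mem_insert_of_mem hf
  exact {
    loP := hM.left_mem e h0
    hiP := hM.right_mem e h0
    iso_lo := fun f hf => ⟨(hM.no_shared f (hin f hf) e h0 (hne f hf)).1,
      (hM.no_shared f (hin f hf) e h0 (hne f hf)).2.2.1⟩
    iso_hi := fun f hf => ⟨(hM.no_shared f (hin f hf) e h0 (hne f hf)).2.1,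
      (hM.no_shared f (hin f hf) e h0 (hne f hf)).2.2.2⟩
    lt := hM.x_lt e h0
    ne := fun f hf t h1 h2 => yOn_ne hM (hin f hf) h0 (hne f hf) h1.1 h1.2 h2.1 h2.2 }

theorem cR_adm {P : Finset Pt} {M : Finset (Pt × Pt)} {e : Pt × Pt}
    (hM : IsMatching P (insert e M)) (he : e ∉ M) : (cR P M).adm e := by
  have h0 := Finset.mem_insert_self e M
  have hne : ∀ f ∈ M, f ≠ e := fun f hf h => he (h ▸ hf)
  have hin : ∀ f ∈ M, f ∈ insert e M := fun f hf => Finset.mem_insert_of_mem hf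
  exact {
    loP := hM.right_mem e h0
    hiP := hM.left_mem e h0
    iso_lo := fun f hf => ⟨(hM.no_shared f (hin f hf) e h0 (hne f hf)).2.2.2,
      (hM.no_shared f (hin f hf) e h0 (hne f hf)).2.1⟩
    iso_hi := fun f hf => ⟨(hM.no_shared f (hin f hf) e h0 (hne f hf)).2.2.1,
      (hM.no_shared f (hin f hf) e h0 (hne f hf)).1⟩
    lt := neg_lt_neg (hM.x_lt e h0)
    ne := fun f hf t h1 h2 => yOn_ne hM (hin f hf) h0 (hne f hf)
      (by have := h1.2; simp only [cR] at this; linarith)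
      (by have := h1.1; simp only [cR] at this; linarith)
      (by have := h2.2; simp only [cR] at this; linarith)
      (by have := h2.1; simp only [cR] at this; linarith) }

theorem vis_LR {P : Finset Pt} {M : Finset (Pt × Pt)} {e : Pt × Pt} {z : Pt} :
    (cR P M).vis e z ↔ (cL P M).vis e z := by
  unfold Cfg.vis Cfg.In
  simp only [cL, cR, neg_lt_neg_iff, neg_le_neg_iff, neg_neg]
  constructor
  · rintro ⟨h1, h2, h3⟩
    exact ⟨h2, h1, fun f hf h => h3 f hf ⟨h.2, h.1⟩⟩
  · rintro ⟨h1, h2, h3⟩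
    exact ⟨h2, h1, fun f hf h => h3 f hf ⟨h.2, h.1⟩⟩

theorem nI_LR {P : Finset Pt} {M : Finset (Pt × Pt)} {e : Pt × Pt} :
    (cR P M).nI e (-e.1.1) = (cL P M).nI e e.2.1 := by
  unfold Cfg.nI
  congr 1
  apply Finset.filter_congr
  intro z _
  rw [vis_LR]
  constructor
  · rintro ⟨h1, h2, -⟩
    exact ⟨fun f hf => (h1 f hf).symm, h2, h2.2.1⟩
  · rintro ⟨h1, h2, -⟩
    exact ⟨fun f hf => (h1 f hf).symm, h2, neg_lt_neg h2.1⟩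

def Heavy (P : Finset Pt) (M : Finset (Pt × Pt)) (z : Pt) : Prop :=
  (cL P M).LH z ∧ (cR P M).LH z

noncomputable def hR (P : Finset Pt) (M : Finset (Pt × Pt)) (e : Pt × Pt) : ℕ :=
  if Heavy P M e.2 then (cL P M).WG (Heavy P M) 4 e.2.1 e
  else (cL P M).WH (Heavy P M) 4 e.2.1 e

noncomputable def hL (P : Finset Pt) (M : Finset (Pt × Pt)) (e : Pt × Pt) : ℕ :=
  if Heavy P M e.1 then (cR P M).WG (Heavy P M) 4 (-e.1.1) e
  else (cR P M).WH (Heavy P M) 4 (-e.1.1) e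

theorem hR_hL (P : Finset Pt) (M : Finset (Pt × Pt)) (e : Pt × Pt) :
    16 ≤ hR P M e + hL P M e + 2 * (2 * (cL P M).nI e e.2.1 + (cL P M).nR e e.2.1 +
      (cR P M).nR e (-e.1.1)) := by
  unfold hR hL Cfg.WG Cfg.WH
  rw [nI_LR]
  have e1 : (cL P M).lo e = e.1 := rfl
  have e2 : (cR P M).lo e = e.2 := rfl
  rw [e1, e2]
  generalize (cL P M).nI e e.2.1 = i
  generalize (cL P M).nR e e.2.1 = r
  generalize (cR P M).nR e (-e.1.1) = l
  by_cases h1 : Heavy P M e.1 <;> by_cases h2 : Heavy P M e.2 <;>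
    simp only [h1, h2, not_true, not_false_iff, and_true, and_false, if_true, if_false] <;>
    (try split_ifs) <;> omega

noncomputable def Ins (P : Finset Pt) (M : Finset (Pt × Pt)) : Finset (Pt × Pt) :=
  (P ×ˢ P).filter fun e => e ∉ M ∧ IsMatching P (insert e M)

theorem point_bound {P : Finset Pt} {M : Finset (Pt × Pt)} (hP : GenPos P) (hM : IsMatching P M)
    (p : Pt) :
    ∑ e ∈ (Ins P M).filter (fun e => e.2 = p), hR P M e +
    ∑ e ∈ (Ins P M).filter (fun e => e.1 = p), hL P M e ≤ 45 := by
  have hA : ∀ σ ∈ (Ins P M).filter (fun e => e.2 = p), (cL P M).adm σ ∧ (cL P M).hi σ = p := by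
    intro σ hσ
    obtain ⟨h1, h2⟩ := Finset.mem_filter.1 hσ
    obtain ⟨-, h3, h4⟩ := Finset.mem_filter.1 h1
    exact ⟨cL_adm h4 h3, h2⟩
  have hB : ∀ σ ∈ (Ins P M).filter (fun e => e.1 = p), (cR P M).adm σ ∧ (cR P M).hi σ = p := by
    intro σ hσ
    obtain ⟨h1, h2⟩ := Finset.mem_filter.1 hσ
    obtain ⟨-, h3, h4⟩ := Finset.mem_filter.1 h1
    exact ⟨cR_adm h4 h3, h2⟩
  have iA : Set.InjOn (cL P M).lo (((Ins P M).filter (fun e => e.2 = p) : Finset (Pt × Pt)) :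
      Set (Pt × Pt)) := by
    intro x hx y hy h
    exact Prod.ext h (((hA x hx).2).trans ((hA y hy).2).symm)
  have iB : Set.InjOn (cR P M).lo (((Ins P M).filter (fun e => e.1 = p) : Finset (Pt × Pt)) :
      Set (Pt × Pt)) := by
    intro x hx y hy h
    exact Prod.ext (((hB x hx).2).trans ((hB y hy).2).symm) h
  have oL := cL_Ok hP hM
  have oR := cR_Ok hP hM
  by_cases hp : Heavy P M p
  · have h1 := Cfg.side_G oL hA iA (Heavy P M) (fun z hz => hz.1)
    have h2 := Cfg.side_G oR hB iB (Heavy P M) (fun z hz => hz.2)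
    rw [Finset.sum_congr rfl (fun e he => show hR P M e =
        (cL P M).WG (Heavy P M) 4 ((cL P M).X p) e by
        have : e.2 = p := (hA e he).2
        unfold hR; rw [this, if_pos hp]; rfl),
      Finset.sum_congr (s₁ := (Ins P M).filter (fun e => e.1 = p)) rfl (fun e he =>
        show hL P M e = (cR P M).WG (Heavy P M) 4 ((cR P M).X p) e by
        have : e.1 = p := (hB e he).2
        unfold hL; rw [this, if_pos hp]; rfl)]
    exact (add_le_add h1 h2).trans (by norm_num)
  · have h1 := Cfg.side_H oL hA iA (Heavy P M) (fun z hz => hz.1)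
    have h2 := Cfg.side_H oR hB iB (Heavy P M) (fun z hz => hz.2)
    have h3 := Cfg.side_H' oL hA iA (Heavy P M) (fun z hz => hz.1)
    have h4 := Cfg.side_H' oR hB iB (Heavy P M) (fun z hz => hz.2)
    rw [Finset.sum_congr rfl (fun e he => show hR P M e =
        (cL P M).WH (Heavy P M) 4 ((cL P M).X p) e by
        have : e.2 = p := (hA e he).2
        unfold hR; rw [this, if_neg hp]; rfl),
      Finset.sum_congr (s₁ := (Ins P M).filter (fun e => e.1 = p)) rfl (fun e he =>
        show hL P M e = (cR P M).WH (Heavy P M) 4 ((cR P M).X p) e by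
        have : e.1 = p := (hB e he).2
        unfold hL; rw [this, if_neg hp]; rfl)]
    rcases not_and_or.1 hp with h | h
    · exact add_le_add (h3 h) h2
    · exact add_le_add h1 (h4 h)

theorem IsMatching.mono {P : Finset Pt} {M N : Finset (Pt × Pt)} (hM : IsMatching P M)
    (h : N ⊆ M) : IsMatching P N where
  left_mem e he := hM.left_mem e (h he)
  right_mem e he := hM.right_mem e (h he)
  x_lt e he := hM.x_lt e (h he)
  no_shared e he f hf := hM.no_shared e (h he) f (h hf)
  no_cross e he f hf := hM.no_cross e (h he) f (h hf)

noncomputable def isoSet (P : Finset Pt) (M : Finset (Pt × Pt)) : Finset Pt :=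
  P.filter fun p => Isolated M p

theorem isoSet_card {P : Finset Pt} {M : Finset (Pt × Pt)} (hM : IsMatching P M) :
    (isoSet P M).card + 2 * M.card ≤ P.card := by
  have h1 : (M.image Prod.fst).card = M.card := by
    apply Finset.card_image_of_injOn
    intro e he f hf h
    by_contra hc
    exact (hM.no_shared e he f hf hc).1 h
  have h2 : (M.image Prod.snd).card = M.card := by
    apply Finset.card_image_of_injOn
    intro e he f hf h
    by_contra hc
    exact (hM.no_shared e he f hf hc).2.2.2 h
  have d1 : Disjoint (M.image Prod.fst) (M.image Prod.snd) := by
    rw [Finset.disjoint_left]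
    intro z hz hz'
    obtain ⟨e, he, rfl⟩ := Finset.mem_image.1 hz
    obtain ⟨f, hf, h⟩ := Finset.mem_image.1 hz'
    by_cases hc : e = f
    · subst hc
      have := hM.x_lt e he
      rw [h] at this
      exact lt_irrefl _ this
    · exact (hM.no_shared e he f hf hc).2.1 h.symm
  have d2 : Disjoint (isoSet P M) (M.image Prod.fst ∪ M.image Prod.snd) := by
    rw [Finset.disjoint_left]
    intro z hz hz'
    have hi := (Finset.mem_filter.1 hz).2
    rcases Finset.mem_union.1 hz' with h | h
    · obtain ⟨e, he, h⟩ := Finset.mem_image.1 h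
      exact (hi e he).1 h
    · obtain ⟨e, he, h⟩ := Finset.mem_image.1 h
      exact (hi e he).2 h
  have h3 := Finset.card_union_of_disjoint d1
  have h4 := Finset.card_union_of_disjoint d2
  have h5 : isoSet P M ∪ (M.image Prod.fst ∪ M.image Prod.snd) ⊆ P := by
    refine Finset.union_subset (Finset.filter_subset _ _) (Finset.union_subset ?_ ?_)
    · intro z hz
      obtain ⟨e, he, rfl⟩ := Finset.mem_image.1 hz
      exact hM.left_mem e he
    · intro z hz
      obtain ⟨e, he, rfl⟩ := Finset.mem_image.1 hz
      exact hM.right_mem e he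
  have h6 := Finset.card_le_card h5
  omega

theorem vis_two {P : Finset Pt} {M : Finset (Pt × Pt)} (hP : GenPos P) (hM : IsMatching P M)
    {z : Pt} (hz : z ∈ P) :
    (M.filter fun e => (cL P (M.erase e)).vis e z).card ≤ 2 := by
  have hz0 : ∀ e ∈ M, (cL P (M.erase e)).vis e z → yOn e z.1 ≠ z.2 := by
    intro e he hv h
    have a : e.1.1 < z.1 := hv.1
    have b : z.1 < e.2.1 := hv.2.1
    rcases yOn_gp hP (hM.left_mem e he) (hM.right_mem e he) hz (hM.x_lt e he) h with rfl | rfl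
    · exact lt_irrefl _ a
    · exact lt_irrefl _ b
  have hle : ∀ e ∈ M, ∀ f ∈ M, e ≠ f → (cL P (M.erase e)).vis e z → (cL P (M.erase f)).vis f z →
      0 ≤ (yOn f z.1 - z.2) * (yOn f z.1 - yOn e z.1) := by
    intro e he f hf hne hv hv'
    exact hv.2.2 f (Finset.mem_erase.2 ⟨hne.symm, hf⟩) ⟨le_of_lt hv'.1, le_of_lt hv'.2.1⟩
  have hneq : ∀ e ∈ M, ∀ f ∈ M, e ≠ f → (cL P (M.erase e)).vis e z → (cL P (M.erase f)).vis f z →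
      yOn e z.1 ≠ yOn f z.1 := by
    intro e he f hf hne hv hv'
    exact yOn_ne hM he hf hne (le_of_lt hv.1) (le_of_lt hv.2.1) (le_of_lt hv'.1) (le_of_lt hv'.2.1)
  rw [← Finset.card_filter_add_card_filter_not (fun e => z.2 < yOn e z.1)]
  have c1 : ((M.filter fun e => (cL P (M.erase e)).vis e z).filter
      (fun e => z.2 < yOn e z.1)).card ≤ 1 := by
    rw [Finset.card_le_one]
    intro e he f hf
    simp only [Finset.mem_filter] at he hf
    obtain ⟨⟨he, ve⟩, ze⟩ := he
    obtain ⟨⟨hf, vf⟩, zf⟩ := hf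
    by_contra hne
    have h1 := hle e he f hf hne ve vf
    have h2 := hle f hf e he (Ne.symm hne) vf ve
    rcases lt_or_gt_of_ne (hneq e he f hf hne ve vf) with h | h
    · linarith [mul_neg_of_pos_of_neg (sub_pos.2 ze) (sub_neg.2 h)]
    · linarith [mul_neg_of_pos_of_neg (sub_pos.2 zf) (sub_neg.2 h)]
  have c2 : ((M.filter fun e => (cL P (M.erase e)).vis e z).filter
      (fun e => ¬ z.2 < yOn e z.1)).card ≤ 1 := by
    rw [Finset.card_le_one]
    intro e he f hf
    simp only [Finset.mem_filter] at he hf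
    obtain ⟨⟨he, ve⟩, ze⟩ := he
    obtain ⟨⟨hf, vf⟩, zf⟩ := hf
    have ze := lt_of_le_of_ne (not_lt.1 ze) (hz0 e he ve)
    have zf := lt_of_le_of_ne (not_lt.1 zf) (hz0 f hf vf)
    by_contra hne
    have h1 := hle e he f hf hne ve vf
    have h2 := hle f hf e he (Ne.symm hne) vf ve
    rcases lt_or_gt_of_ne (hneq e he f hf hne ve vf) with h | h
    · linarith [mul_neg_of_neg_of_pos (sub_neg.2 zf) (sub_pos.2 h)]
    · linarith [mul_neg_of_neg_of_pos (sub_neg.2 ze) (sub_pos.2 h)]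
  exact add_le_add c1 c2

theorem count_le {P : Finset Pt} {M : Finset (Pt × Pt)} (hP : GenPos P) (hM : IsMatching P M)
    (D : Finset Pt) (hD : D ⊆ P) (N : Pt × Pt → Finset Pt)
    (hN : ∀ e ∈ M, ∀ z ∈ N e, z ∈ D ∧ (cL P (M.erase e)).vis e z) :
    ∑ e ∈ M, (N e).card ≤ 2 * D.card := by
  calc ∑ e ∈ M, (N e).card
      ≤ ∑ e ∈ M, (D.filter fun z => (cL P (M.erase e)).vis e z).card := by
        refine Finset.sum_le_sum fun e he => Finset.card_le_card fun z hz => ?_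
        exact Finset.mem_filter.2 (hN e he z hz)
    _ = ∑ z ∈ D, (M.filter fun e => (cL P (M.erase e)).vis e z).card :=
        Finset.sum_card_bipartiteAbove_eq_sum_card_bipartiteBelow _
    _ ≤ ∑ z ∈ D, 2 := Finset.sum_le_sum fun z hz => vis_two hP hM (hD hz)
    _ = 2 * D.card := by simp [mul_comm]

theorem matching_bound {P : Finset Pt} {M : Finset (Pt × Pt)} (hP : GenPos P)
    (hM : IsMatching P M) :
    16 * M.card ≤ ∑ e ∈ M, (hR P (M.erase e) e + hL P (M.erase e) e) +
      8 * (isoSet P M).card + 8 * M.card := by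
  have s1 : ∑ e ∈ M, (cL P (M.erase e)).nI e e.2.1 ≤ 2 * (isoSet P M).card := by
    unfold Cfg.nI
    refine count_le hP hM _ (Finset.filter_subset _ _) _ ?_
    intro e he z hz
    obtain ⟨h1, h2, h3, -⟩ := Finset.mem_filter.1 hz
    refine ⟨Finset.mem_filter.2 ⟨h1, fun f hf => ?_⟩, h3⟩
    by_cases hfe : f = e
    · subst hfe
      have a : f.1.1 < z.1 := h3.1
      have b : z.1 < f.2.1 := h3.2.1
      exact ⟨fun h => by rw [h] at a; exact lt_irrefl _ a,
        fun h => by rw [h] at b; exact lt_irrefl _ b⟩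
    · exact h2 f (Finset.mem_erase.2 ⟨hfe, hf⟩)
  have s2 : ∑ e ∈ M, (cL P (M.erase e)).nR e e.2.1 ≤ 2 * M.card := by
    unfold Cfg.nR
    refine le_trans (count_le hP hM (M.image Prod.snd) ?_ _ ?_)
      (Nat.mul_le_mul le_rfl Finset.card_image_le)
    · intro z hz
      obtain ⟨e, he, rfl⟩ := Finset.mem_image.1 hz
      exact hM.right_mem e he
    · intro e he z hz
      obtain ⟨h1, ⟨f, hf, hfz⟩, h3, -⟩ := Finset.mem_filter.1 hz
      exact ⟨Finset.mem_image.2 ⟨f, Finset.mem_of_mem_erase hf, hfz⟩, h3⟩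
  have s3 : ∑ e ∈ M, (cR P (M.erase e)).nR e (-e.1.1) ≤ 2 * M.card := by
    unfold Cfg.nR
    refine le_trans (count_le hP hM (M.image Prod.fst) ?_ _ ?_)
      (Nat.mul_le_mul le_rfl Finset.card_image_le)
    · intro z hz
      obtain ⟨e, he, rfl⟩ := Finset.mem_image.1 hz
      exact hM.left_mem e he
    · intro e he z hz
      obtain ⟨h1, ⟨f, hf, hfz⟩, h3, -⟩ := Finset.mem_filter.1 hz
      exact ⟨Finset.mem_image.2 ⟨f, Finset.mem_of_mem_erase hf, hfz⟩, vis_LR.1 h3⟩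
  have s4 : ∑ e ∈ M, 16 ≤ ∑ e ∈ M, (hR P (M.erase e) e + hL P (M.erase e) e +
      2 * (2 * (cL P (M.erase e)).nI e e.2.1 + (cL P (M.erase e)).nR e e.2.1 +
      (cR P (M.erase e)).nR e (-e.1.1))) :=
    Finset.sum_le_sum fun e _ => hR_hL P (M.erase e) e
  simp only [Finset.sum_add_distrib, ← Finset.mul_sum, Finset.sum_const, smul_eq_mul] at s4 ⊢
  omega

theorem Ins_bound {P : Finset Pt} {M : Finset (Pt × Pt)} (hP : GenPos P) (hM : IsMatching P M) :
    ∑ e ∈ Ins P M, (hR P M e + hL P M e) ≤ 45 * (isoSet P M).card := by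
  have hiso : ∀ e ∈ Ins P M, e.1 ∈ isoSet P M ∧ e.2 ∈ isoSet P M := by
    intro e he
    obtain ⟨-, h3, h4⟩ := Finset.mem_filter.1 he
    have ha := cL_adm h4 h3
    exact ⟨Finset.mem_filter.2 ⟨ha.loP, ha.iso_lo⟩, Finset.mem_filter.2 ⟨ha.hiP, ha.iso_hi⟩⟩
  rw [Finset.sum_add_distrib,
    ← Finset.sum_fiberwise_of_maps_to (g := Prod.snd) (fun e he => (hiso e he).2) (hR P M),
    ← Finset.sum_fiberwise_of_maps_to (g := Prod.fst) (fun e he => (hiso e he).1) (hL P M),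
    ← Finset.sum_add_distrib]
  calc _ ≤ ∑ p ∈ isoSet P M, 45 := Finset.sum_le_sum fun p _ => by
        convert point_bound hP hM p
    _ = 45 * (isoSet P M).card := by simp [mul_comm]

theorem mem_Matchings {P : Finset Pt} {m : ℕ} {M : Finset (Pt × Pt)} :
    M ∈ Matchings P m ↔ IsMatching P M ∧ M.card = m := by
  unfold Matchings
  rw [Finset.mem_filter, Finset.mem_powerset]
  constructor
  · exact fun h => h.2
  · exact fun h => ⟨fun e he => Finset.mem_product.2 ⟨h.1.left_mem e he, h.1.right_mem e he⟩, h⟩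

theorem double_count (P : Finset Pt) (m : ℕ) (φ : Finset (Pt × Pt) → Pt × Pt → ℕ) :
    ∑ M ∈ Matchings P (m + 1), ∑ e ∈ M, φ (M.erase e) e =
    ∑ M ∈ Matchings P m, ∑ e ∈ Ins P M, φ M e := by
  rw [Finset.sum_sigma', Finset.sum_sigma']
  refine Finset.sum_bij' (fun x _ => ⟨x.1.erase x.2, x.2⟩) (fun x _ => ⟨insert x.2 x.1, x.2⟩)
    ?_ ?_ ?_ ?_ ?_
  · rintro ⟨M, e⟩ h
    obtain ⟨h1, h2⟩ := Finset.mem_sigma.1 h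
    obtain ⟨h3, h4⟩ := mem_Matchings.1 h1
    simp only at h2
    refine Finset.mem_sigma.2 ⟨mem_Matchings.2 ⟨h3.mono (Finset.erase_subset _ _), ?_⟩, ?_⟩
    · rw [Finset.card_erase_of_mem h2, h4]; rfl
    · refine Finset.mem_filter.2 ⟨Finset.mem_product.2 ⟨h3.left_mem e h2, h3.right_mem e h2⟩,
        Finset.notMem_erase _ _, ?_⟩
      rw [Finset.insert_erase h2]; exact h3
  · rintro ⟨M, e⟩ h
    obtain ⟨h1, h2⟩ := Finset.mem_sigma.1 h
    obtain ⟨-, h3, h4⟩ := Finset.mem_filter.1 h2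
    refine Finset.mem_sigma.2 ⟨mem_Matchings.2 ⟨h4, ?_⟩, Finset.mem_insert_self _ _⟩
    rw [Finset.card_insert_of_notMem h3, (mem_Matchings.1 h1).2]
  · rintro ⟨M, e⟩ h
    obtain ⟨h1, h2⟩ := Finset.mem_sigma.1 h
    simp only at h2
    simp [Finset.insert_erase h2]
  · rintro ⟨M, e⟩ h
    obtain ⟨h1, h2⟩ := Finset.mem_sigma.1 h
    obtain ⟨-, h3, h4⟩ := Finset.mem_filter.1 h2
    simp only at h3
    simp [Finset.erase_insert h3]
  · rintro ⟨M, e⟩ h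
    rfl

/-- For every integer `m ≥ 1`, writing `s = n − 2m`,
one has `(2n − 6s)·Ma_m(P) ≤ (68/3)·(s + 2)·Ma_{m−1}(P)`. -/
theorem Ma_recurrence_four_improved (P : Finset Pt) (hP : GenPos P)
    (m : ℕ) (hm : 1 ≤ m) :
    (2 * (P.card : ℚ) - 6 * ((P.card : ℚ) - 2 * m)) * Ma P m ≤
      (68 / 3) * (((P.card : ℚ) - 2 * m) + 2) * Ma P (m - 1) := by
  obtain ⟨k, rfl⟩ : ∃ k, m = k + 1 := ⟨m - 1, by omega⟩
  simp only [Nat.add_sub_cancel]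
  set A : ℕ := ∑ M ∈ Matchings P (k + 1), ∑ e ∈ M, (hR P (M.erase e) e + hL P (M.erase e) e) with hA
  have h1 : (∑ M ∈ Matchings P (k + 1), (32 * (k + 1) : ℕ)) ≤
      ∑ M ∈ Matchings P (k + 1),
        (∑ e ∈ M, (hR P (M.erase e) e + hL P (M.erase e) e) + (8 * P.card + 8 * (k + 1))) := by
    refine Finset.sum_le_sum fun M hM => ?_
    obtain ⟨a, b⟩ := mem_Matchings.1 hM
    have c := matching_bound hP a
    have d := isoSet_card a
    rw [b] at c d
    omega
  rw [Finset.sum_add_distrib, ← hA, Finset.sum_const, Finset.sum_const, smul_eq_mul,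
    smul_eq_mul] at h1
  have h2 : A + ∑ M ∈ Matchings P k, 45 * (2 * k) ≤ ∑ M ∈ Matchings P k, 45 * P.card := by
    rw [hA, double_count P k (fun M e => hR P M e + hL P M e), ← Finset.sum_add_distrib]
    refine Finset.sum_le_sum fun M hM => ?_
    obtain ⟨a, b⟩ := mem_Matchings.1 hM
    have c := Ins_bound hP a
    have d := isoSet_card a
    rw [b] at d
    omega
  rw [Finset.sum_const, Finset.sum_const, smul_eq_mul, smul_eq_mul] at h2
  have h3 : 0 ≤ ((P.card : ℚ) - 2 * k) * (Matchings P k).card := by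
    rcases (Matchings P k).eq_empty_or_nonempty with h | ⟨M, hM⟩
    · simp [h]
    · obtain ⟨a, b⟩ := mem_Matchings.1 hM
      have d := isoSet_card a
      rw [b] at d
      have : (2 * k : ℚ) ≤ P.card := by exact_mod_cast (by omega : 2 * k ≤ P.card)
      exact mul_nonneg (by linarith) (Nat.cast_nonneg _)
  have h1' : ((Matchings P (k + 1)).card : ℚ) * (32 * (k + 1)) ≤
      A + (Matchings P (k + 1)).card * (8 * P.card + 8 * (k + 1)) := by exact_mod_cast h1
  have h2' : (A : ℚ) + (Matchings P k).card * (45 * (2 * k)) ≤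
      (Matchings P k).card * (45 * P.card) := by exact_mod_cast h2
  unfold Ma
  push_cast
  generalize ((Matchings P (k + 1)).card : ℚ) = x at *
  generalize ((Matchings P k).card : ℚ) = y at *
  generalize (P.card : ℚ) = n at *
  nlinarith
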